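/- For the operators K± = √((1∓ε)/2)(I ± ε(I + σ_x)) with 0 ≤ ε ≤ 1, the unrecorded-outcome map ρ ↦ Σ_{i,j} (K_i⊗K_j)ρ(K_i⊗K_j)^† sends every entangled pure state of the form cos(θ/2)|00⟩ + sin(θ/2)|11⟩ (0 < θ < π) to a separable state if and only if ε = 1/√2. -/

import Mathlib

open Matrix Kronecker

noncomputable def pauliY : Matrix (Fin 2) (Fin 2) ℂ := !![0, -Complex.I; Complex.I, 0]

noncomputable def spinFlip (σ : Matrix (Fin 2 × Fin 2) (Fin 2 × Fin 2) ℂ) :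
    Matrix (Fin 2 × Fin 2) (Fin 2 × Fin 2) ℂ :=
  (pauliY ⊗ₖ pauliY) * σ.map star * (pauliY ⊗ₖ pauliY)

/-- Wootters' concurrence. -/
noncomputable def concurrence (ρ : Matrix (Fin 2 × Fin 2) (Fin 2 × Fin 2) ℂ) : ℝ :=
  let s := (((ρ * spinFlip ρ).charpoly.roots).map (fun z => Real.sqrt z.re)).toList
  max 0 (2 * s.foldr max 0 - s.sum)

noncomputable def pauliX : Matrix (Fin 2) (Fin 2) ℂ := !![0, 1; 1, 0]

/-- K± = √((1∓ε)/2)(I ± ε(I + σ_x)), with s = ±1 encoding the sign. -/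
noncomputable def Kop (ε : ℝ) (s : ℝ) : Matrix (Fin 2) (Fin 2) ℂ :=
  (Real.sqrt ((1 - s * ε) / 2) : ℂ) •
    ((1 : Matrix (Fin 2) (Fin 2) ℂ) + ((s * ε : ℝ) : ℂ) • ((1 : Matrix (Fin 2) (Fin 2) ℂ) + pauliX))

/-- The Schmidt-form pure state cos(θ/2)|00⟩ + sin(θ/2)|11⟩. -/
noncomputable def schmidtVec (θ : ℝ) : Fin 2 × Fin 2 → ℂ :=
  fun p => !![(Real.cos (θ / 2) : ℂ), 0; 0, (Real.sin (θ / 2) : ℂ)] p.1 p.2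

/-- The unrecorded-outcome K-measurement map applied to |ψ(θ)⟩⟨ψ(θ)|. -/
noncomputable def Kout (ε θ : ℝ) : Matrix (Fin 2 × Fin 2) (Fin 2 × Fin 2) ℂ :=
  ∑ s ∈ ({1, -1} : Finset ℝ), ∑ t ∈ ({1, -1} : Finset ℝ),
    (Kop ε s ⊗ₖ Kop ε t) * vecMulVec (schmidtVec θ) (star (schmidtVec θ)) *
      (Kop ε s ⊗ₖ Kop ε t)ᴴ

/-- The symmetric X-shaped matrix with outer block `!![a, b; b, a]` and inner block
`!![c, d; d, c]`. -/
noncomputable def symmX (a b c d : ℝ) : Matrix (Fin 2 × Fin 2) (Fin 2 × Fin 2) ℂ :=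
  (!![(a : ℂ), 0, 0, b; 0, c, d, 0; 0, d, c, 0; b, 0, 0, a]).submatrix
    finProdFinEquiv finProdFinEquiv

theorem symmX_mul_spinFlip (a b c d : ℝ) :
    symmX a b c d * spinFlip (symmX a b c d) =
      symmX (a ^ 2 + b ^ 2) (2 * a * b) (c ^ 2 + d ^ 2) (2 * c * d) := by
  ext ⟨i, j⟩ ⟨k, l⟩
  fin_cases i <;> fin_cases j <;> fin_cases k <;> fin_cases l <;>
    simp [symmX, spinFlip, pauliY, Matrix.mul_apply, Fintype.sum_prod_type, finProdFinEquiv] <;>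
    ring

theorem charpoly_symmX (a b c d : ℝ) :
    (symmX a b c d).charpoly =
      (({((a + b : ℝ) : ℂ), ((a - b : ℝ) : ℂ), ((c + d : ℝ) : ℂ), ((c - d : ℝ) : ℂ)} :
        Multiset ℂ).map (fun z => Polynomial.X - Polynomial.C z)).prod := by
  have h : symmX a b c d = Matrix.reindex finProdFinEquiv.symm finProdFinEquiv.symm
      !![(a : ℂ), 0, 0, b; 0, c, d, 0; 0, d, c, 0; b, 0, 0, a] := rfl
  rw [h, Matrix.charpoly_reindex, Matrix.charpoly]
  simp [Matrix.det_succ_row_zero, Fin.sum_univ_succ, Matrix.charmatrix_apply, Fin.succAbove]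
  ring

theorem concurrence_symmX (a b c d : ℝ) :
    concurrence (symmX a b c d) =
      max 0 (2 * max |a + b| (max |a - b| (max |c + d| (max |c - d| 0))) -
        (|a + b| + (|a - b| + (|c + d| + |c - d|)))) := by
  have hroots : ((symmX a b c d * spinFlip (symmX a b c d)).charpoly.roots).map
      (fun z => Real.sqrt z.re) = ↑[|a + b|, |a - b|, |c + d|, |c - d|] := by
    rw [symmX_mul_spinFlip, charpoly_symmX, Polynomial.roots_multiset_prod_X_sub_C]
    have h₁ (x y : ℝ) : √(x ^ 2 + y ^ 2 + 2 * x * y) = |x + y| := by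
      rw [← Real.sqrt_sq_eq_abs]; ring_nf
    have h₂ (x y : ℝ) : √(x ^ 2 + y ^ 2 - 2 * x * y) = |x - y| := by
      rw [← Real.sqrt_sq_eq_abs]; ring_nf
    simp only [Multiset.insert_eq_cons, Multiset.map_cons, Multiset.map_singleton,
      Complex.ofReal_re, h₁, h₂]
    rfl
  have hperm : (Multiset.toList (↑[|a + b|, |a - b|, |c + d|, |c - d|] : Multiset ℝ)).Perm
      [|a + b|, |a - b|, |c + d|, |c - d|] := Multiset.coe_eq_coe.mp (Multiset.coe_toList _)
  simp only [concurrence, hroots]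
  rw [hperm.foldr_eq, hperm.sum_eq]
  simp

theorem Kop_conj (ε s t : ℝ) (hs : 0 ≤ (1 - s * ε) / 2) (ht : 0 ≤ (1 - t * ε) / 2)
    (ρ : Matrix (Fin 2 × Fin 2) (Fin 2 × Fin 2) ℂ) :
    (Kop ε s ⊗ₖ Kop ε t) * ρ * (Kop ε s ⊗ₖ Kop ε t)ᴴ =
      (((1 - s * ε) / 2 * ((1 - t * ε) / 2) : ℝ) : ℂ) •
        ((!![(1 + s * ε : ℂ), s * ε; s * ε, 1 + s * ε] ⊗ₖ
          !![(1 + t * ε : ℂ), t * ε; t * ε, 1 + t * ε]) * ρ *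
        (!![(1 + s * ε : ℂ), s * ε; s * ε, 1 + s * ε] ⊗ₖ
          !![(1 + t * ε : ℂ), t * ε; t * ε, 1 + t * ε])ᴴ) := by
  have hK (u : ℝ) : Kop ε u = (Real.sqrt ((1 - u * ε) / 2) : ℂ) •
      !![(1 + u * ε : ℂ), u * ε; u * ε, 1 + u * ε] := by
    rw [Kop]
    congr 1
    ext i j
    fin_cases i <;> fin_cases j <;> simp [pauliX]
  rw [hK, hK, Matrix.smul_kronecker, Matrix.kronecker_smul, smul_smul, Matrix.conjTranspose_smul,
    Matrix.smul_mul, Matrix.smul_mul, Matrix.mul_smul, smul_smul]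
  congr 1
  rw [star_mul', Complex.star_def, Complex.conj_ofReal, Complex.conj_ofReal,
    mul_mul_mul_comm, ← Complex.ofReal_mul, ← Complex.ofReal_mul, ← Complex.ofReal_mul,
    Real.mul_self_sqrt hs, Real.mul_self_sqrt ht]

theorem kronecker_mulVec_diag (x y c s : ℂ) :
    (!![1 + x, x; x, 1 + x] ⊗ₖ !![1 + y, y; y, 1 + y]) *ᵥ
        (fun p => !![c, 0; 0, s] p.1 p.2 : Fin 2 × Fin 2 → ℂ) =
      fun p => !![(1 + x) * (1 + y) * c + x * y * s, (1 + x) * y * c + x * (1 + y) * s;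
        x * (1 + y) * c + (1 + x) * y * s, x * y * c + (1 + x) * (1 + y) * s] p.1 p.2 := by
  ext ⟨i, j⟩
  fin_cases i <;> fin_cases j <;>
    simp [Matrix.mulVec, dotProduct, Fintype.sum_prod_type]

/-- The output state, a local bit-flip channel of strength `ε ^ 2` on each qubit. -/
theorem Kout_eq (ε θ : ℝ) (hε0 : 0 ≤ ε) (hε1 : ε ≤ 1) (c s : ℝ)
    (hc : Real.cos (θ / 2) = c) (hs : Real.sin (θ / 2) = s) :
    Kout ε θ =
      (!![((((1 - ε ^ 2) ^ 2 * c ^ 2 + (ε ^ 2) ^ 2 * s ^ 2 : ℝ)) : ℂ), 0, 0,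
            (((((1 - ε ^ 2) ^ 2 + (ε ^ 2) ^ 2) * (c * s) : ℝ)) : ℂ);
          0, ((ε ^ 2 * (1 - ε ^ 2) * (c ^ 2 + s ^ 2) : ℝ) : ℂ),
            ((ε ^ 2 * (1 - ε ^ 2) * (2 * (c * s)) : ℝ) : ℂ), 0;
          0, ((ε ^ 2 * (1 - ε ^ 2) * (2 * (c * s)) : ℝ) : ℂ),
            ((ε ^ 2 * (1 - ε ^ 2) * (c ^ 2 + s ^ 2) : ℝ) : ℂ), 0;
          (((((1 - ε ^ 2) ^ 2 + (ε ^ 2) ^ 2) * (c * s) : ℝ)) : ℂ), 0, 0,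
            ((((1 - ε ^ 2) ^ 2 * s ^ 2 + (ε ^ 2) ^ 2 * c ^ 2 : ℝ)) : ℂ)]).submatrix
        finProdFinEquiv finProdFinEquiv := by
  have h₁ : 0 ≤ (1 - 1 * ε) / 2 := by linarith
  have h₂ : 0 ≤ (1 - -1 * ε) / 2 := by linarith
  have hne : (1 : ℝ) ∉ ({-1} : Finset ℝ) := by norm_num
  simp only [Kout, Finset.sum_insert hne, Finset.sum_singleton]
  rw [Kop_conj _ _ _ h₁ h₁, Kop_conj _ _ _ h₁ h₂, Kop_conj _ _ _ h₂ h₁, Kop_conj _ _ _ h₂ h₂]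
  simp only [Matrix.mul_vecMulVec, Matrix.vecMulVec_mul, ← Matrix.star_mulVec]
  have hψ : schmidtVec θ = fun p => !![(c : ℂ), 0; 0, (s : ℂ)] p.1 p.2 := by
    subst hc hs
    rfl
  simp only [hψ, kronecker_mulVec_diag]
  ext ⟨i, j⟩ ⟨k, l⟩
  fin_cases i <;> fin_cases j <;> fin_cases k <;> fin_cases l <;>
    simp [Matrix.vecMulVec_apply, finProdFinEquiv] <;>
    ring

theorem Kout_pi_div_two (ε : ℝ) (hε0 : 0 ≤ ε) (hε1 : ε ≤ 1) :
    Kout ε (Real.pi / 2) =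
      symmX (((1 - ε ^ 2) ^ 2 + (ε ^ 2) ^ 2) / 2) (((1 - ε ^ 2) ^ 2 + (ε ^ 2) ^ 2) / 2)
        (ε ^ 2 * (1 - ε ^ 2)) (ε ^ 2 * (1 - ε ^ 2)) := by
  have hπ : Real.pi / 2 / 2 = Real.pi / 4 := by ring
  have h2 : (√2 / 2 : ℝ) ^ 2 = 1 / 2 := by rw [div_pow, Real.sq_sqrt (by norm_num)]; norm_num
  rw [Kout_eq ε _ hε0 hε1 (√2 / 2) (√2 / 2) (by rw [hπ, Real.cos_pi_div_four])
    (by rw [hπ, Real.sin_pi_div_four]), symmX, ← sq, h2]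
  congr 2
  ring_nf

theorem Kout_of_sq_eq_half (ε θ : ℝ) (hε0 : 0 ≤ ε) (hε1 : ε ≤ 1) (h : ε ^ 2 = 1 / 2) :
    Kout ε θ = symmX (1 / 4) (Real.sin θ / 4) (1 / 4) (Real.sin θ / 4) := by
  have h1 := Real.sin_sq_add_cos_sq (θ / 2)
  have h2 : Real.sin θ = 2 * Real.sin (θ / 2) * Real.cos (θ / 2) := by
    rw [← Real.sin_two_mul]; ring_nf
  rw [Kout_eq ε θ hε0 hε1 _ _ rfl rfl, symmX, h, h2]
  have e1 : (1 - 1 / 2 : ℝ) ^ 2 * Real.cos (θ / 2) ^ 2 + (1 / 2) ^ 2 * Real.sin (θ / 2) ^ 2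
      = 1 / 4 := by linear_combination h1 / 4
  have e2 : (1 - 1 / 2 : ℝ) ^ 2 * Real.sin (θ / 2) ^ 2 + (1 / 2) ^ 2 * Real.cos (θ / 2) ^ 2
      = 1 / 4 := by linear_combination h1 / 4
  have e3 : (1 / 2 * (1 - 1 / 2) : ℝ) * (Real.cos (θ / 2) ^ 2 + Real.sin (θ / 2) ^ 2)
      = 1 / 4 := by linear_combination h1 / 4
  rw [e1, e2, e3]
  congr 2
  ring_nf

/-- The unrecorded-outcome map breaks the entanglement of every entangled
Schmidt-form pure state iff ε = 1/√2. -/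
theorem K_measurement_breaks_all_iff
    (ε : ℝ) (hε0 : 0 ≤ ε) (hε1 : ε ≤ 1) :
    (∀ θ : ℝ, 0 < θ → θ < Real.pi → concurrence (Kout ε θ) = 0) ↔
      ε = 1 / Real.sqrt 2 := by
  constructor
  · intro h
    have hC := h (Real.pi / 2) (by positivity) (by linarith [Real.pi_pos])
    rw [Kout_pi_div_two ε hε0 hε1, concurrence_symmX] at hC
    have hp : ε ^ 2 ≤ 1 := by nlinarith
    have hr : 0 ≤ ε ^ 2 * (1 - ε ^ 2) := mul_nonneg (sq_nonneg _) (by linarith)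
    have hq : 0 ≤ (1 - ε ^ 2) ^ 2 + (ε ^ 2) ^ 2 := by positivity
    rw [sub_self, sub_self, abs_zero, add_halves, abs_of_nonneg hq,
      abs_of_nonneg (add_nonneg hr hr), max_eq_left_iff] at hC
    have hmax := le_max_left ((1 - ε ^ 2) ^ 2 + (ε ^ 2) ^ 2)
      (max 0 (max (ε ^ 2 * (1 - ε ^ 2) + ε ^ 2 * (1 - ε ^ 2)) (max 0 0)))
    have hsq : (1 - 2 * ε ^ 2) ^ 2 = 0 :=
      le_antisymm (by linarith) (sq_nonneg _)
    have hhalf : ε ^ 2 = 1 / 2 := by linarith [pow_eq_zero_iff (two_ne_zero) |>.mp hsq]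
    rw [← Real.sqrt_sq hε0, hhalf, Real.sqrt_div' _ (by norm_num), Real.sqrt_one]
  · intro h θ hθ0 hθπ
    have hhalf : ε ^ 2 = 1 / 2 := by
      rw [h, div_pow, Real.sq_sqrt (by norm_num), one_pow]
    have hs0 := Real.sin_pos_of_pos_of_lt_pi hθ0 hθπ
    have hs1 := Real.sin_le_one θ
    rw [Kout_of_sq_eq_half ε θ hε0 hε1 hhalf, concurrence_symmX,
      abs_of_nonneg (by linarith : 0 ≤ 1 / 4 + Real.sin θ / 4),
      abs_of_nonneg (by linarith : 0 ≤ 1 / 4 - Real.sin θ / 4), max_eq_left_iff]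
    have hmax : max (1 / 4 + Real.sin θ / 4) (max (1 / 4 - Real.sin θ / 4)
        (max (1 / 4 + Real.sin θ / 4) (max (1 / 4 - Real.sin θ / 4) 0))) ≤ 1 / 2 := by
      simp only [max_le_iff]
      refine ⟨?_, ?_, ?_, ?_, ?_⟩ <;> linarith
    linarith
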